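/- Let G be a connected finite simple graph that is even-hole-free and claw-free, with vertex weights b_v ∈ ℝ∖{0}, let K_s be a simplicial clique of G, and let G_χ be the extended graph obtained by adding a new vertex χ adjacent exactly to the vertices of K_s. Then for every real number x: Σ_{L} (−x)^{|L|−1} · [P_{C_L}(x)]² · ∏_{w∈L, w≠χ} b_w² = P_G(x) · P_{G∖K_s}(x), where the sum runs over all induced paths L in G_χ whose first vertex is χ (including the one-vertex path (χ)). -/

import Mathlib

/-- A graph is claw-free if it contains no induced `K_{1,3}`. -/
def ClawFree {V : Type*} (G : SimpleGraph V) : Prop :=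
  ¬ ∃ c a b d : V, a ≠ b ∧ a ≠ d ∧ b ≠ d ∧
    G.Adj c a ∧ G.Adj c b ∧ G.Adj c d ∧
    ¬ G.Adj a b ∧ ¬ G.Adj a d ∧ ¬ G.Adj b d

/-- `ℓ 0, ℓ 1, …, ℓ (m-1)` is an induced path in `G`. -/
def IsInducedPath {V : Type*} (G : SimpleGraph V) (m : ℕ) (ℓ : ℕ → V) : Prop :=
  (∀ a b, a < m → b < m → ℓ a = ℓ b → a = b) ∧
  ∀ a b, a < m → b < m → (G.Adj (ℓ a) (ℓ b) ↔ (a + 1 = b ∨ b + 1 = a))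

/-- `c 0, c 1, …, c (q-1)` is an induced cycle in `G`. -/
def IsInducedCycle {V : Type*} (G : SimpleGraph V) (q : ℕ) (c : ℕ → V) : Prop :=
  3 ≤ q ∧
  (∀ a b, a < q → b < q → c a = c b → a = b) ∧
  ∀ a b, a < q → b < q → (G.Adj (c a) (c b) ↔ ((a + 1) % q = b ∨ (b + 1) % q = a))

/-- A graph is even-hole-free if it contains no even induced cycle. -/
def EvenHoleFree {V : Type*} (G : SimpleGraph V) : Prop :=
  ¬ ∃ (q : ℕ) (c : ℕ → V), Even q ∧ IsInducedCycle G q c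

/-- A finset of vertices is a clique. -/
def IsClique {V : Type*} (G : SimpleGraph V) (K : Finset V) : Prop :=
  ∀ u ∈ K, ∀ v ∈ K, u ≠ v → G.Adj u v

/-- A clique `K` is simplicial if for every `v ∈ K` the set `Γ[v] ∖ K` is a clique. -/
def IsSimplicialClique {V : Type*} (G : SimpleGraph V) (K : Finset V) : Prop :=
  IsClique G K ∧
  ∀ v ∈ K, ∀ u u' : V, (u = v ∨ G.Adj u v) → u ∉ K → (u' = v ∨ G.Adj u' v) → u' ∉ K →
    u ≠ u' → G.Adj u u'

/-- The extended graph `G_χ`: a new vertex `χ` (represented by `none`) is adjacent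
exactly to the vertices of `K`. -/
def extGraph {V : Type*} (G : SimpleGraph V) (K : Finset V) : SimpleGraph (Option V) :=
  SimpleGraph.fromRel (fun x y =>
    (∃ u v : V, x = some u ∧ y = some v ∧ G.Adj u v) ∨
    (∃ v : V, x = none ∧ y = some v ∧ v ∈ K))

/-- The list `l = [ℓ₁, …, ℓ_n]` encodes the rooted path `χ – ℓ₁ – ⋯ – ℓ_n`:
this predicate says that this sequence is an induced path in the extended graph. -/
def IsRootedPath {V : Type*} (G : SimpleGraph V) (K : Finset V) (l : List V) : Prop :=
  IsInducedPath (extGraph G K) (l.length + 1)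
    (fun a => (none :: l.map some).getD a none)

/-- The residual graph of a rooted path: the vertices of `G` outside `K` (the closed
neighborhood of `χ` in `G`) and outside the closed neighborhood of every path vertex. -/
def residualSet {V : Type*} [Fintype V] [DecidableEq V] (G : SimpleGraph V)
    [DecidableRel G.Adj] (K : Finset V) (l : List V) : Finset V :=
  Finset.univ.filter (fun x => x ∉ K ∧ ∀ w ∈ l, ¬ (x = w ∨ G.Adj x w))

/-- The weighted independence polynomial of the induced subgraph of `G` on `A`. -/
noncomputable def indepPoly {V : Type*} [DecidableEq V] (G : SimpleGraph V)
    [DecidableRel G.Adj] (b : V → ℝ) (A : Finset V) (x : ℝ) : ℝ :=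
  ∑ S ∈ A.powerset.filter (fun S => ∀ u ∈ S, ∀ v ∈ S, u ≠ v → ¬ G.Adj u v),
    (-x) ^ S.card * ∏ v ∈ S, (b v) ^ 2

section RootedPaths

variable {V : Type*}

/-- Prepending a vertex to an induced path. -/
lemma isInducedPath_succ (G : SimpleGraph V) (m : ℕ) (ℓ : ℕ → V) :
    IsInducedPath G (m + 1) ℓ ↔ IsInducedPath G m (fun a => ℓ (a + 1)) ∧
      ∀ a, a < m → ℓ 0 ≠ ℓ (a + 1) ∧ (G.Adj (ℓ 0) (ℓ (a + 1)) ↔ a = 0) := by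
  constructor
  · rintro ⟨hinj, hadj⟩
    refine ⟨⟨fun a c ha hc h => ?_, fun a c ha hc => ?_⟩, fun a ha => ⟨fun h => ?_, ?_⟩⟩
    · have := hinj (a + 1) (c + 1) (by omega) (by omega) h
      omega
    · rw [hadj (a + 1) (c + 1) (by omega) (by omega)]
      omega
    · have := hinj 0 (a + 1) (by omega) (by omega) h
      omega
    · rw [hadj 0 (a + 1) (by omega) (by omega)]
      omega
  · rintro ⟨⟨hinj, hadj⟩, h0⟩
    refine ⟨fun a c ha hc h => ?_, fun a c ha hc => ?_⟩
    · rcases a with _ | a <;> rcases c with _ | c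
      · rfl
      · exact absurd h (h0 c (by omega)).1
      · exact absurd h.symm (h0 a (by omega)).1
      · rw [hinj a c (by omega) (by omega) h]
    · rcases a with _ | a <;> rcases c with _ | c
      · simp
      · rw [(h0 c (by omega)).2]
        omega
      · rw [G.adj_comm, (h0 a (by omega)).2]
        omega
      · rw [hadj a c (by omega) (by omega)]
        omega

lemma extGraph_adj_some (G : SimpleGraph V) (K : Finset V) (u v : V) :
    (extGraph G K).Adj (some u) (some v) ↔ G.Adj u v := by
  simp only [extGraph, SimpleGraph.fromRel_adj]
  constructor
  · rintro ⟨-, h⟩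
    simpa [G.adj_comm v u] using h
  · intro h
    exact ⟨by simpa using h.ne, by simp [h]⟩

lemma extGraph_adj_none (G : SimpleGraph V) (K : Finset V) (v : V) :
    (extGraph G K).Adj none (some v) ↔ v ∈ K := by
  simp [extGraph, SimpleGraph.fromRel_adj]

/-- The list `l` is an induced path of the graph `G`, viewed inside `extGraph G K`. -/
def IsListPath (G : SimpleGraph V) (K : Finset V) (l : List V) : Prop :=
  IsInducedPath (extGraph G K) l.length (fun a => (l.map some).getD a none)

lemma isListPath_cons (G : SimpleGraph V) (K : Finset V) (v : V) (l : List V) :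
    IsListPath G K (v :: l) ↔ IsListPath G K l ∧
      ∀ (a : ℕ) (h : a < l.length), v ≠ l[a] ∧ (G.Adj v l[a] ↔ a = 0) := by
  unfold IsListPath
  rw [List.length_cons, isInducedPath_succ]
  refine and_congr (by simp) (forall₂_congr fun a ha => ?_)
  simp [ha, extGraph_adj_some]

lemma isRootedPath_iff (G : SimpleGraph V) (K : Finset V) (l : List V) :
    IsRootedPath G K l ↔ IsListPath G K l ∧
      ∀ (a : ℕ) (h : a < l.length), (l[a] ∈ K ↔ a = 0) := by
  unfold IsRootedPath IsListPath
  rw [isInducedPath_succ]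
  refine and_congr (by simp) (forall₂_congr fun a ha => ?_)
  simp [ha, extGraph_adj_none]

variable [DecidableEq V]

/-- The rooted paths inside `A` of at most `n` vertices whose first vertex, and no other one,
lies in `K`. -/
def pathsFrom (G : SimpleGraph V) [DecidableRel G.Adj] :
    ℕ → Finset V → Finset V → Finset (List V)
  | 0, _, _ => {[]}
  | n + 1, A, K => insert [] (K.biUnion fun v =>
      (pathsFrom G n (A \ K) ((A \ K).filter (G.Adj v))).image (List.cons v))

lemma mem_pathsFrom (G : SimpleGraph V) [DecidableRel G.Adj] (K₀ : Finset V) (n : ℕ)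
    (A K : Finset V) (hKA : K ⊆ A) (hn : A.card ≤ n) (l : List V) :
    l ∈ pathsFrom G n A K ↔ IsListPath G K₀ l ∧
      ∀ (a : ℕ) (h : a < l.length), l[a] ∈ A ∧ (l[a] ∈ K ↔ a = 0) := by
  have hnil : IsListPath G K₀ [] := ⟨fun a c ha => by simp at ha, fun a c ha => by simp at ha⟩
  induction n generalizing A K l with
  | zero =>
    have hA : A = ∅ := by simpa using hn
    rcases l with _ | ⟨v, l⟩
    · simpa [pathsFrom] using hnil
    · simp only [pathsFrom, Finset.mem_singleton, reduceCtorEq, false_iff]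
      rintro ⟨-, h⟩
      simpa [hA] using (h 0 (by simp)).1
  | succ n ih =>
    rcases l with _ | ⟨v, l⟩
    · simpa [pathsFrom] using hnil
    · have hcard : v ∈ K → (A \ K).card ≤ n := fun hv => by
        have := Finset.card_lt_card (Finset.sdiff_ssubset hKA ⟨v, hv⟩)
        omega
      have hmem : (v :: l) ∈ pathsFrom G (n + 1) A K ↔
          v ∈ K ∧ l ∈ pathsFrom G n (A \ K) ((A \ K).filter (G.Adj v)) := by
        simp [pathsFrom]
      rw [hmem, isListPath_cons]
      constructor
      · rintro ⟨hv, hl⟩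
        obtain ⟨hl, h⟩ := (ih _ _ (Finset.filter_subset _ _) (hcard hv) _).1 hl
        simp only [Finset.mem_filter, Finset.mem_sdiff] at h
        refine ⟨⟨hl, fun a ha => ?_⟩, fun a ha => ?_⟩
        · have := h a ha
          refine ⟨fun hva => this.1.2 (hva ▸ hv), by tauto⟩
        · rcases a with _ | a
          · simp [hv, hKA hv]
          · have := h a (by simpa using ha)
            simpa using this.1
      · rintro ⟨⟨hl, h⟩, hA⟩
        have hv : v ∈ K := (hA 0 (by simp)).2.2 rfl
        refine ⟨hv, (ih _ _ (Finset.filter_subset _ _) (hcard hv) _).2 ⟨hl, fun a ha => ?_⟩⟩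
        have h1 := h a ha
        have h2 := hA (a + 1) (by simpa using ha)
        simp only [List.getElem_cons_succ] at h2
        simp only [Finset.mem_filter, Finset.mem_sdiff]
        have h3 : l[a] ∉ K := fun hK => by simpa using h2.2.1 hK
        tauto

variable (G : SimpleGraph V) [DecidableRel G.Adj] (b : V → ℝ) (x : ℝ)

lemma indepPoly_insert {v : V} {A : Finset V} (hv : v ∉ A) :
    indepPoly G b (insert v A) x = indepPoly G b A x +
      (-x) * b v ^ 2 * indepPoly G b (A.filter fun u => ¬ G.Adj v u) x := by
  have hsplit : (insert v A).powerset.filter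
      (fun S => ∀ u ∈ S, ∀ w ∈ S, u ≠ w → ¬ G.Adj u w) =
      A.powerset.filter (fun S => ∀ u ∈ S, ∀ w ∈ S, u ≠ w → ¬ G.Adj u w) ∪
      (((A.filter fun u => ¬ G.Adj v u).powerset.filter
        (fun S => ∀ u ∈ S, ∀ w ∈ S, u ≠ w → ¬ G.Adj u w)).image (insert v)) := by
    rw [Finset.powerset_insert, Finset.filter_union, Finset.filter_image]
    congr 2
    ext S
    simp only [Finset.mem_filter, Finset.mem_powerset, Finset.subset_iff]
    constructor
    · rintro ⟨hS, h⟩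
      refine ⟨fun u hu => ⟨hS hu, h v (by simp) u (by simp [hu]) ?_⟩,
        fun u hu w hw => h u (by simp [hu]) w (by simp [hw])⟩
      intro h_eq
      exact hv (h_eq ▸ hS hu)
    · rintro ⟨hS, h⟩
      refine ⟨fun u hu => (hS hu).1, fun u hu w hw huw => ?_⟩
      rcases Finset.mem_insert.1 hu with rfl | hu' <;>
        rcases Finset.mem_insert.1 hw with rfl | hw'
      · exact absurd rfl huw
      · exact (hS hw').2
      · rw [G.adj_comm]
        exact (hS hu').2
      · exact h u hu' w hw' huw
  have hnot : ∀ S ∈ (A.filter fun u => ¬ G.Adj v u).powerset.filter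
      (fun S => ∀ u ∈ S, ∀ w ∈ S, u ≠ w → ¬ G.Adj u w), v ∉ S := fun S hS hvS => by
    simp only [Finset.mem_filter, Finset.mem_powerset] at hS
    exact hv (Finset.filter_subset _ _ (hS.1 hvS))
  unfold indepPoly
  rw [hsplit, Finset.sum_union, Finset.sum_image, Finset.mul_sum]
  · congr 1
    refine Finset.sum_congr rfl fun S hS => ?_
    rw [Finset.card_insert_of_notMem (hnot S hS), Finset.prod_insert (hnot S hS)]
    ring
  · intro S hS T hT h
    rw [← Finset.erase_insert (hnot S hS), ← Finset.erase_insert (hnot T hT)]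
    exact congrArg (fun U => U.erase v) h
  · rw [Finset.disjoint_left]
    intro S hS hS'
    obtain ⟨T, -, rfl⟩ := Finset.mem_image.1 hS'
    simp only [Finset.mem_filter, Finset.mem_powerset] at hS
    exact hv (hS.1 (Finset.mem_insert_self _ _))

lemma indepPoly_union_clique {B K : Finset V} (hK : IsClique G K) (hd : Disjoint K B) :
    indepPoly G b (K ∪ B) x = indepPoly G b B x +
      ∑ v ∈ K, (-x) * b v ^ 2 * indepPoly G b (B.filter fun u => ¬ G.Adj v u) x := by
  induction K using Finset.induction_on with
  | empty => simp
  | insert v K hv ih =>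
    rw [Finset.disjoint_insert_left] at hd
    have hfil : (K ∪ B).filter (fun u => ¬ G.Adj v u) = B.filter fun u => ¬ G.Adj v u := by
      rw [Finset.filter_union, Finset.union_eq_right]
      intro u hu
      rw [Finset.mem_filter] at hu
      exact absurd (hK v (by simp) u (by simp [hu.1]) fun h => hv (h ▸ hu.1)) hu.2
    rw [Finset.insert_union, indepPoly_insert G b x (by simp [hv, hd.1]), hfil,
      ih (fun u hu w hw => hK u (by simp [hu]) w (by simp [hw])) hd.2, Finset.sum_insert hv]
    ring

/-- The path-product identity for the subgraph induced on `A`. -/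
lemma sum_pathsFrom (hcf : ClawFree G) (n : ℕ) (A K : Finset V) (hKA : K ⊆ A)
    (hn : A.card ≤ n) (hK : IsClique G K)
    (hs : ∀ v ∈ K, ∀ u ∈ A \ K, ∀ w ∈ A \ K, G.Adj v u → G.Adj v w → u ≠ w → G.Adj u w) :
    ∑ l ∈ pathsFrom G n A K, (-x) ^ l.length *
        indepPoly G b (A.filter fun y => y ∉ K ∧ ∀ w ∈ l, ¬ (y = w ∨ G.Adj y w)) x ^ 2 *
          (l.map fun w => (b w) ^ 2).prod
      = indepPoly G b A x * indepPoly G b (A \ K) x := by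
  induction n generalizing A K with
  | zero =>
    obtain rfl : A = ∅ := by simpa using hn
    obtain rfl : K = ∅ := by simpa using hKA
    simp [pathsFrom, sq]
  | succ n ih =>
    have hrec : ∀ v ∈ K, ∑ l ∈ pathsFrom G n (A \ K) ((A \ K).filter (G.Adj v)),
        (-x) ^ (v :: l).length * indepPoly G b
          (A.filter fun y => y ∉ K ∧ ∀ w ∈ v :: l, ¬ (y = w ∨ G.Adj y w)) x ^ 2 *
          ((v :: l).map fun w => (b w) ^ 2).prod =
        (-x) * b v ^ 2 * indepPoly G b ((A \ K).filter fun u => ¬ G.Adj v u) x *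
          indepPoly G b (A \ K) x := by
      intro v hv
      have hcard := Finset.card_lt_card (Finset.sdiff_ssubset hKA ⟨v, hv⟩)
      have hsd : (A \ K) \ (A \ K).filter (G.Adj v) = (A \ K).filter fun u => ¬ G.Adj v u := by
        rw [Finset.filter_not]
      have key := ih (A \ K) ((A \ K).filter (G.Adj v)) (Finset.filter_subset _ _) (by omega) ?_ ?_
      · rw [hsd] at key
        rw [mul_assoc, mul_comm (indepPoly G b _ x), ← key, Finset.mul_sum]
        refine Finset.sum_congr rfl fun l _ => ?_
        have hres : (A.filter fun y => y ∉ K ∧ ∀ w ∈ v :: l, ¬ (y = w ∨ G.Adj y w)) =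
            (A \ K).filter fun y => y ∉ (A \ K).filter (G.Adj v) ∧
              ∀ w ∈ l, ¬ (y = w ∨ G.Adj y w) := by
          ext y
          simp only [Finset.mem_filter, Finset.mem_sdiff, List.forall_mem_cons, G.adj_comm y v]
          have : y = v → y ∈ K := fun h => h ▸ hv
          tauto
        rw [hres]
        simp only [List.length_cons, List.map_cons, List.prod_cons]
        ring
      · intro u hu w hw huw
        rw [Finset.mem_filter] at hu hw
        exact hs v hv u hu.1 w hw.1 hu.2 hw.2 huw
      · intro u hu p hp q hq hup huq hpq
        rw [hsd, Finset.mem_filter, Finset.mem_sdiff] at hp hq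
        rw [Finset.mem_filter] at hu
        by_contra hpq'
        exact hcf ⟨u, v, p, q, fun h => hp.1.2 (h ▸ hv), fun h => hq.1.2 (h ▸ hv), hpq,
          hu.2.symm, hup, huq, hp.2, hq.2, hpq'⟩
    have hA : indepPoly G b A x = indepPoly G b (A \ K) x + ∑ v ∈ K, (-x) * b v ^ 2 *
        indepPoly G b ((A \ K).filter fun u => ¬ G.Adj v u) x := by
      rw [← indepPoly_union_clique G b x hK Finset.disjoint_sdiff,
        Finset.union_sdiff_of_subset hKA]
    rw [pathsFrom, Finset.sum_insert (by simp), Finset.sum_biUnion, hA, add_mul, Finset.sum_mul]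
    · congr 1
      · simp [sq, Finset.filter_notMem_eq_sdiff]
      · refine Finset.sum_congr rfl fun v hv => ?_
        rw [Finset.sum_image fun _ _ _ _ h => (List.cons.inj h).2]
        exact hrec v hv
    · intro v _ w _ hvw
      rw [Function.onFun, Finset.disjoint_left]
      intro l hl hl'
      obtain ⟨l₁, -, rfl⟩ := Finset.mem_image.1 hl
      obtain ⟨l₂, -, h⟩ := Finset.mem_image.1 hl'
      exact hvw (List.cons.inj h).1.symm

lemma sum_pathsFrom_univ [Fintype V] (hcf : ClawFree G) {K : Finset V}
    (hK : IsSimplicialClique G K) :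
    ∑ l ∈ pathsFrom G (Fintype.card V) Finset.univ K, (-x) ^ l.length *
        indepPoly G b (residualSet G K l) x ^ 2 * (l.map fun w => (b w) ^ 2).prod
      = indepPoly G b Finset.univ x * indepPoly G b (Finset.univ \ K) x := by
  convert sum_pathsFrom G b x hcf (Fintype.card V) Finset.univ K (Finset.subset_univ K)
    (Finset.card_le_univ _) hK.1 ?_ using 6
  · unfold residualSet
    congr
  intro v hv u hu w hw hvu hvw huw
  rw [Finset.mem_sdiff] at hu hw
  exact hK.2 v hv u w (Or.inr hvu.symm) hu.2 (Or.inr hvw.symm) hw.2 huw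

lemma setOf_isRootedPath [Fintype V] (K : Finset V) :
    {l : List V | IsRootedPath G K l} = ↑(pathsFrom G (Fintype.card V) Finset.univ K) := by
  ext l
  rw [Set.mem_ofPred_eq, isRootedPath_iff, Finset.mem_coe,
    mem_pathsFrom G K _ _ _ (Finset.subset_univ K) (Finset.card_le_univ _)]
  simp

end RootedPaths

/-- The one-variable path-product identity for independence polynomials:
`Σ_L (-x)^{|L|-1} P_{C_L}(x)² ∏_{w∈L, w≠χ} b_w² = P_G(x) · P_{G∖K_s}(x)`. -/
theorem stmt_10 {V : Type*} [Fintype V] [DecidableEq V] (G : SimpleGraph V)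
    [DecidableRel G.Adj] (hconn : G.Connected)
    (hehf : EvenHoleFree G) (hcf : ClawFree G)
    (b : V → ℝ) (hb : ∀ w, b w ≠ 0)
    (K : Finset V) (hK : IsSimplicialClique G K)
    (x : ℝ) :
    ∑ᶠ l ∈ {l : List V | IsRootedPath G K l},
        (-x) ^ l.length * (indepPoly G b (residualSet G K l) x) ^ 2 *
          (l.map fun w => (b w) ^ 2).prod
      = indepPoly G b Finset.univ x * indepPoly G b (Finset.univ \ K) x := by
  rw [setOf_isRootedPath, finsum_mem_coe_finset]
  exact sum_pathsFrom_univ G b x hcf hK
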